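/- Let q be a prime with q ≡ 1 (mod 4) or q = 2, and let s be an integer with q ∣ Φ₄(s − 1), where Φ₄(x) = x² + 1. Define n₄(x) = q·x² + (2s − 2)·x + Φ₄(s − 1)/q, p₄(x) = Φ₆(q·x + s) with Φ₆(x) = x² − x + 1, and t₄(x) = q·x + s. Then for every integer x: (i) q·n₄(x) = p₄(x) + 1 − t₄(x); (ii) q·n₄(x) divides Φ₄(p₄(x)); (iii) t₄(x)² − 4·p₄(x) ≤ 0. Moreover n₄ and p₄ are irreducible as polynomials over ℤ. -/

import Mathlib

open Polynomial

/-- The 4th cyclotomic polynomial, evaluated at an integer. -/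
def Phi4 (x : ℤ) : ℤ := x ^ 2 + 1

/-- The 6th cyclotomic polynomial, evaluated at an integer. -/
def Phi6 (x : ℤ) : ℤ := x ^ 2 - x + 1

/-- An integer quadratic with negative discriminant whose coefficients have no common non-unit
divisor is irreducible over `ℤ`. -/
theorem irreducible_quadratic_of_discrim_neg {a b c : ℤ} (hdisc : b ^ 2 - 4 * a * c < 0)
    (hprim : ∀ r : ℤ, r ∣ a → r ∣ b → r ∣ c → IsUnit r) :
    Irreducible (C a * X ^ 2 + C b * X + C c : ℤ[X]) := by
  have ha : a ≠ 0 := by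
    rintro rfl
    nlinarith [sq_nonneg b]
  have hdeg : (C a * X ^ 2 + C b * X + C c : ℤ[X]).natDegree = 2 := natDegree_quadratic ha
  have hconst : ∀ r : ℤ, C r ∣ (C a * X ^ 2 + C b * X + C c : ℤ[X]) → IsUnit (C r : ℤ[X]) := by
    intro r hr
    rw [C_dvd_iff_dvd_coeff] at hr
    refine isUnit_C.2 (hprim r ?_ ?_ ?_)
    · simpa [coeff_X, coeff_C, -eq_intCast] using hr 2
    · simpa [coeff_X, coeff_C, -eq_intCast] using hr 1
    · simpa [-eq_intCast] using hr 0
  refine ⟨fun hu => ?_, fun f g hfg => ?_⟩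
  · have := natDegree_eq_zero_of_isUnit hu
    omega
  have hne : (C a * X ^ 2 + C b * X + C c : ℤ[X]) ≠ 0 := by
    intro h
    rw [h, natDegree_zero] at hdeg
    omega
  have hf : f ≠ 0 := by
    rintro rfl
    exact hne (by rw [hfg, zero_mul])
  have hg : g ≠ 0 := by
    rintro rfl
    exact hne (by rw [hfg, mul_zero])
  have hsum : f.natDegree + g.natDegree = 2 := by
    rw [← natDegree_mul hf hg, ← hfg, hdeg]
  obtain hf0 | hg0 | ⟨hf1, hg1⟩ : f.natDegree = 0 ∨ g.natDegree = 0 ∨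
      (f.natDegree = 1 ∧ g.natDegree = 1) := by omega
  · left
    rw [eq_C_of_natDegree_eq_zero hf0] at hfg ⊢
    exact hconst _ ⟨g, hfg⟩
  · right
    rw [eq_C_of_natDegree_eq_zero hg0] at hfg ⊢
    exact hconst _ ⟨f, by rw [hfg, mul_comm]⟩
  · exfalso
    obtain ⟨u, -, v, rfl⟩ := natDegree_eq_one.1 hf1
    obtain ⟨w, -, z, rfl⟩ := natDegree_eq_one.1 hg1
    have hexp : (C u * X + C v) * (C w * X + C z) =
        (C (u * w) * X ^ 2 + C (u * z + v * w) * X + C (v * z) : ℤ[X]) := by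
      simp only [C_mul, C_add]
      ring
    rw [hexp] at hfg
    have h2 : a = u * w := by
      simpa [coeff_X, coeff_C, -eq_intCast, -map_mul] using congrArg (coeff · 2) hfg
    have h1 : b = u * z + v * w := by
      simpa [coeff_X, coeff_C, -eq_intCast, -map_mul] using congrArg (coeff · 1) hfg
    have h0 : c = v * z := by simpa [-eq_intCast, -map_mul] using congrArg (coeff · 0) hfg
    subst h2 h1 h0
    nlinarith [sq_nonneg (u * z - v * w)]

theorem mnt_family_k4_case_phi4_shift (q : ℤ) (hq : Prime q) (hmod : q % 4 = 1 ∨ q = 2)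
    (s : ℤ) (hdvd : q ∣ Phi4 (s - 1))
    (n4 : ℤ → ℤ) (hn4 : ∀ x, n4 x = q * x ^ 2 + (2 * s - 2) * x + Phi4 (s - 1) / q)
    (p4 : ℤ → ℤ) (hp4 : ∀ x, p4 x = Phi6 (q * x + s))
    (t4 : ℤ → ℤ) (ht4 : ∀ x, t4 x = q * x + s) :
    (∀ x : ℤ, q * n4 x = p4 x + 1 - t4 x) ∧
    (∀ x : ℤ, q * n4 x ∣ Phi4 (p4 x)) ∧
    (∀ x : ℤ, t4 x ^ 2 - 4 * p4 x ≤ 0) ∧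
    Irreducible (C q * X ^ 2 + C (2 * s - 2) * X + C (Phi4 (s - 1) / q)) ∧
    Irreducible ((C q * X + C s) ^ 2 - (C q * X + C s) + 1) := by
  obtain ⟨c, hc⟩ := hdvd
  have hq0 : q ≠ 0 := hq.ne_zero
  have hquot : Phi4 (s - 1) / q = c := by rw [hc, Int.mul_ediv_cancel_left _ hq0]
  rw [hquot]
  simp only [hquot] at hn4
  unfold Phi4 at hc
  have hn : ∀ x : ℤ, q * n4 x = p4 x + 1 - t4 x := by
    intro x
    rw [hn4, hp4, ht4, Phi6]
    linear_combination -hc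
  have hndvd : ¬ q ∣ s - 1 := by
    rintro ⟨k, hk⟩
    exact hq.not_isUnit
      (isUnit_of_dvd_one ⟨c - k * (s - 1), by linear_combination hc - (s - 1) * hk⟩)
  refine ⟨hn, fun x => ?_, fun x => ?_, ?_, ?_⟩
  · rw [hn, hp4, ht4, Phi6, Phi4]
    exact ⟨(q * x + s) ^ 2 + 1, by ring⟩
  · rw [hp4, ht4, Phi6]
    nlinarith [sq_nonneg (3 * (q * x + s) - 2)]
  · refine irreducible_quadratic_of_discrim_neg (by nlinarith) fun r hrq hrb hrc => ?_
    by_contra hr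
    have hqr : q ∣ r := (hq.irreducible.dvd_iff.1 hrq).resolve_left hr |>.dvd
    have hq2s : q ∣ 2 * (s - 1) := by
      rw [mul_sub_one]
      exact hqr.trans hrb
    have hq2 : q ∣ 2 := (hq.dvd_or_dvd hq2s).resolve_right hndvd
    have hq_eq : q = 2 := by
      have := Int.le_of_dvd two_pos hq2
      have := Int.le_of_dvd two_pos (neg_dvd.2 hq2)
      have hq1 : q ≠ 1 := hq.ne_one
      omega
    subst hq_eq
    obtain ⟨k, rfl⟩ := hqr.trans hrc
    have hmod4 : (s - 1) ^ 2 % 4 = 3 := by omega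
    obtain ⟨m, hm | hm⟩ := Int.even_or_odd' (s - 1) <;> rw [hm] at hmod4 <;> ring_nf at hmod4 <;>
      omega
  · have hquad : (C q * X + C s) ^ 2 - (C q * X + C s) + 1 =
        (C (q ^ 2) * X ^ 2 + C (q * (2 * s - 1)) * X + C (s ^ 2 - s + 1) : ℤ[X]) := by
      simp only [C_mul, C_add, C_sub, C_pow, C_1, C_ofNat]
      ring
    rw [hquad]
    refine irreducible_quadratic_of_discrim_neg ?_ fun r hra _ hrc => ?_
    · nlinarith [sq_pos_of_ne_zero hq0]
    · have hcop : IsCoprime q (s ^ 2 - s + 1) := by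
        refine (hq.irreducible.coprime_iff_not_dvd).2 ?_
        rintro ⟨k, hk⟩
        exact hndvd ⟨k - c, by linear_combination hk - hc⟩
      exact hcop.pow_left.isUnit_of_dvd' hra hrc
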